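/- Let G be a connected graph with at least 2 vertices, having degree vector d, 2-forest matrix S, m edges, τ spanning trees, and let v be any vertex. Then d̃ᵀS̃d̃ = dᵀSd + 8·dᵀSe_v + 8mτ + 12τ, where tilde quantities refer to the graph G̃_v obtained by attaching two pendant vertices at v. -/

import Mathlib

open Matrix SimpleGraph

/-- `T` is a spanning tree of `G`: a subgraph (on the same vertex set) that is
connected and acyclic. -/
def IsSpanningTree {V : Type*} (G T : SimpleGraph V) : Prop :=
  T ≤ G ∧ T.Connected ∧ T.IsAcyclic

/-- The number of spanning trees of `G`. -/
noncomputable def spanningTreeCount {V : Type*} (G : SimpleGraph V) : ℕ :=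
  Nat.card {T : SimpleGraph V // IsSpanningTree G T}

/-- `F` is a spanning 2-forest of `G` separating `i` and `j`: an acyclic subgraph
with exactly two components, one containing `i` and the other containing `j`. -/
def IsTwoForestSep {V : Type*} (G F : SimpleGraph V) (i j : V) : Prop :=
  F ≤ G ∧ F.IsAcyclic ∧ ¬ F.Reachable i j ∧ ∀ x, F.Reachable x i ∨ F.Reachable x j

/-- The `(i,j)` entry of the 2-forest matrix of `G`. -/
noncomputable def twoForestCount {V : Type*} (G : SimpleGraph V) (i j : V) : ℕ :=
  Nat.card {F : SimpleGraph V // IsTwoForestSep G F i j}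

/-- The graph `G̃_v`: `G` with two new pendant vertices attached at `v`. -/
def tildeG {V : Type*} (G : SimpleGraph V) (v : V) : SimpleGraph (V ⊕ Fin 2) :=
  SimpleGraph.fromRel (fun x y =>
    (∃ a b, x = Sum.inl a ∧ y = Sum.inl b ∧ G.Adj a b) ∨
    (x = Sum.inl v ∧ ∃ c, y = Sum.inr c))

/-- The graph `Ĝ_v`: `G` with two new vertices `a, b` adjacent to `v` and to
each other. -/
def hatG {V : Type*} (G : SimpleGraph V) (v : V) : SimpleGraph (V ⊕ Fin 2) :=
  SimpleGraph.fromRel (fun x y =>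
    (∃ a b, x = Sum.inl a ∧ y = Sum.inl b ∧ G.Adj a b) ∨
    (x = Sum.inl v ∧ ∃ c, y = Sum.inr c) ∨
    (x = Sum.inr 0 ∧ y = Sum.inr 1))

/-- The degree vector of `H`, as a real vector. -/
noncomputable def degVec {W : Type*} (H : SimpleGraph W) : W → ℝ :=
  fun i => ((H.neighborSet i).ncard : ℝ)

/-- The number of edges of `H`, as a real number. -/
noncomputable def edgeCount {W : Type*} (H : SimpleGraph W) : ℝ :=
  (H.edgeSet.ncard : ℝ)

/-- The 2-forest matrix of `H`, as a real matrix. -/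
noncomputable def forestMatrix {W : Type*} (H : SimpleGraph W) : Matrix W W ℝ :=
  Matrix.of fun i j => ((twoForestCount H i j : ℝ))

/-- The Kemeny constant of `H`, via the formula `κ = dᵀSd / (4mτ)`. -/
noncomputable def kemeny {W : Type*} [Fintype W] (H : SimpleGraph W) : ℝ :=
  (degVec H ⬝ᵥ (forestMatrix H).mulVec (degVec H)) /
    (4 * edgeCount H * (spanningTreeCount H : ℝ))

/-- The subgraph of `G` with pendant vertices `α` at `v` that has the edges of `F` and the pendant
edges at the vertices of `A`. -/
def pendantExt {V α : Type*} (F : SimpleGraph V) (v : V) (A : Set α) : SimpleGraph (V ⊕ α) where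
  Adj
    | .inl a, .inl b => F.Adj a b
    | .inl a, .inr c => a = v ∧ c ∈ A
    | .inr c, .inl a => a = v ∧ c ∈ A
    | .inr _, .inr _ => False
  symm := ⟨by
    rintro (a | c) (b | d) h
    · exact SimpleGraph.Adj.symm (G := F) h
    · exact h
    · exact h
    · exact h⟩
  loopless := ⟨by
    rintro (a | c) h
    · exact F.irrefl h
    · exact h⟩

section PendantExt

variable {V α : Type*} {F G : SimpleGraph V} {v : V} {A : Set α}

@[simp] lemma pendantExt_adj_inl_inl {a b : V} :
    (pendantExt F v A).Adj (.inl a) (.inl b) ↔ F.Adj a b := Iff.rfl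

@[simp] lemma pendantExt_adj_inl_inr {a : V} {c : α} :
    (pendantExt F v A).Adj (.inl a) (.inr c) ↔ a = v ∧ c ∈ A := Iff.rfl

@[simp] lemma pendantExt_adj_inr_inl {a : V} {c : α} :
    (pendantExt F v A).Adj (.inr c) (.inl a) ↔ a = v ∧ c ∈ A := Iff.rfl

@[simp] lemma pendantExt_adj_inr_inr {c d : α} :
    ¬ (pendantExt F v A).Adj (.inr c) (.inr d) := id

lemma tildeG_eq_pendantExt (G : SimpleGraph V) (v : V) : tildeG G v = pendantExt G v Set.univ := by
  ext x y
  rcases x with a | c <;> rcases y with b | d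
  · simp only [tildeG, SimpleGraph.fromRel_adj, pendantExt_adj_inl_inl]
    have := G.adj_comm a b
    have hne : G.Adj a b → a ≠ b := SimpleGraph.Adj.ne
    simp
    tauto
  all_goals
    simp [tildeG, SimpleGraph.fromRel_adj]
    try omega

lemma pendantExt_le_iff : pendantExt F v A ≤ pendantExt G v Set.univ ↔ F ≤ G := by
  refine ⟨fun h a b hab => @h (.inl a) (.inl b) hab, ?_⟩
  rintro h (a | c) (b | d) hab
  · exact h hab
  · exact ⟨hab.1, trivial⟩
  · exact ⟨hab.1, trivial⟩
  · exact hab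

lemma eq_pendantExt_of_le {H : SimpleGraph (V ⊕ α)} (h : H ≤ pendantExt G v Set.univ) :
    H = pendantExt (H.comap Sum.inl) v {c | H.Adj (.inl v) (.inr c)} := by
  ext x y
  rcases x with a | c <;> rcases y with b | d
  · simp
  · simp only [pendantExt_adj_inl_inr, Set.mem_ofPred_eq]
    refine ⟨fun hx => ?_, ?_⟩
    · obtain ⟨rfl, -⟩ := h hx
      exact ⟨rfl, hx⟩
    · rintro ⟨rfl, hx⟩
      exact hx
  · simp only [pendantExt_adj_inr_inl, Set.mem_ofPred_eq]
    refine ⟨fun hx => ?_, ?_⟩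
    · obtain ⟨rfl, -⟩ := h hx
      exact ⟨rfl, hx.symm⟩
    · rintro ⟨rfl, hx⟩
      exact hx.symm
  · exact ⟨fun hx => (h hx).elim, False.elim⟩

lemma pendantExt_injective :
    Function.Injective fun p : SimpleGraph V × Set α => pendantExt p.1 v p.2 := by
  rintro ⟨F, A⟩ ⟨F', A'⟩ h
  refine Prod.ext ?_ ?_
  · ext a b
    simpa using congrArg (fun H => H.Adj (Sum.inl a) (Sum.inl b)) h
  · ext c
    simpa using congrArg (fun H => H.Adj (Sum.inl v) (Sum.inr c)) h

lemma reachable_of_pendantExt {x y : V ⊕ α} (h : (pendantExt F v A).Reachable x y) :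
    F.Reachable (x.elim id fun _ => v) (y.elim id fun _ => v) := by
  obtain ⟨p⟩ := h
  induction p with
  | nil => exact .refl _
  | @cons x y z hxy _ ih =>
    refine .trans ?_ ih
    rcases x with a | c <;> rcases y with b | d
    · exact SimpleGraph.Adj.reachable hxy
    · obtain ⟨rfl, -⟩ := hxy
      exact .refl _
    · obtain ⟨rfl, -⟩ := hxy
      exact .refl _
    · exact hxy.elim

@[simp] lemma pendantExt_reachable_inl_inl {a b : V} :
    (pendantExt F v A).Reachable (.inl a) (.inl b) ↔ F.Reachable a b :=
  ⟨reachable_of_pendantExt, fun h =>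
    h.map (⟨Sum.inl, fun hab => hab⟩ : F →g pendantExt F v A)⟩

lemma mem_of_pendantExt_reachable_inr {c : α} {y : V ⊕ α}
    (h : (pendantExt F v A).Reachable (.inr c) y) (hy : y ≠ .inr c) : c ∈ A := by
  obtain ⟨p⟩ := h
  cases p with
  | nil => exact absurd rfl hy
  | @cons _ z _ hxy _ =>
    rcases z with b | d
    · exact hxy.2
    · exact hxy.elim

@[simp] lemma pendantExt_reachable_inr_inl {c : α} {a : V} :
    (pendantExt F v A).Reachable (.inr c) (.inl a) ↔ c ∈ A ∧ F.Reachable v a := by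
  refine ⟨fun h => ⟨mem_of_pendantExt_reachable_inr h (by simp), reachable_of_pendantExt h⟩, ?_⟩
  rintro ⟨hc, h⟩
  have hv : (pendantExt F v A).Adj (.inr c) (.inl v) := ⟨rfl, hc⟩
  exact hv.reachable.trans (pendantExt_reachable_inl_inl.2 h)

@[simp] lemma pendantExt_reachable_inl_inr {c : α} {a : V} :
    (pendantExt F v A).Reachable (.inl a) (.inr c) ↔ c ∈ A ∧ F.Reachable a v := by
  rw [SimpleGraph.reachable_comm, pendantExt_reachable_inr_inl, SimpleGraph.reachable_comm]

@[simp] lemma pendantExt_reachable_inr_inr {c d : α} :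
    (pendantExt F v A).Reachable (.inr c) (.inr d) ↔ c = d ∨ (c ∈ A ∧ d ∈ A) := by
  constructor
  · intro h
    by_cases hcd : c = d
    · exact .inl hcd
    · exact .inr ⟨mem_of_pendantExt_reachable_inr h (by simpa using Ne.symm hcd),
        mem_of_pendantExt_reachable_inr h.symm (by simpa using hcd)⟩
  · rintro (rfl | ⟨hc, hd⟩)
    · exact .refl _
    · exact (pendantExt_reachable_inr_inl.2 ⟨hc, .refl v⟩).trans
        (pendantExt_reachable_inl_inr.2 ⟨hd, .refl v⟩)

lemma pendantExt_isAcyclic_iff : (pendantExt F v A).IsAcyclic ↔ F.IsAcyclic := by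
  constructor
  · intro h
    exact h.comap (⟨Sum.inl, fun hab => hab⟩ : F →g pendantExt F v A) Sum.inl_injective
  · intro h
    have key : ∀ c, c ∈ A → ¬ ((pendantExt F v A).deleteEdges
        {s(Sum.inl v, Sum.inr c)}).Reachable (.inl v) (.inr c) := by
      intro c _
      have : (pendantExt F v A).deleteEdges {s(Sum.inl v, Sum.inr c)}
          = pendantExt F v (A \ {c}) := by
        ext x y
        rcases x with a | d <;> rcases y with b | e <;> simp <;> grind
      rw [this]
      simp
    rw [SimpleGraph.isAcyclic_iff_forall_adj_isBridge] at h ⊢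
    rintro (a | c) (b | d) hab
    · have hb := SimpleGraph.isBridge_iff.1 (h hab)
      rw [SimpleGraph.isBridge_iff]
      have : (pendantExt F v A).deleteEdges {s(Sum.inl a, Sum.inl b)}
          = pendantExt (F.deleteEdges {s(a, b)}) v A := by
        ext x y
        rcases x with a | d <;> rcases y with b | e <;> simp
      rw [this]
      simpa using hb
    · obtain ⟨rfl, hd⟩ := hab
      rw [SimpleGraph.isBridge_iff]
      exact key d hd
    · obtain ⟨rfl, hc⟩ := hab
      rw [Sym2.eq_swap, SimpleGraph.isBridge_iff]
      exact key c hc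
    · exact hab.elim

lemma isTwoForestSep_pendantExt_inl_inl {i j : V} :
    IsTwoForestSep (pendantExt G v Set.univ) (pendantExt F v A) (.inl i) (.inl j) ↔
      A = Set.univ ∧ IsTwoForestSep G F i j := by
  simp only [IsTwoForestSep, pendantExt_le_iff, pendantExt_isAcyclic_iff, Sum.forall,
    pendantExt_reachable_inl_inl, pendantExt_reachable_inr_inl, Set.eq_univ_iff_forall]
  grind

lemma isTwoForestSep_pendantExt_inr_inl {c : α} {j : V} :
    IsTwoForestSep (pendantExt G v Set.univ) (pendantExt F v A) (.inr c) (.inl j) ↔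
      (A = Set.univ ∧ IsTwoForestSep G F v j) ∨ (A = {c}ᶜ ∧ IsSpanningTree G F) := by
  simp only [IsTwoForestSep, IsSpanningTree, pendantExt_le_iff, pendantExt_isAcyclic_iff,
    Sum.forall, pendantExt_reachable_inl_inl, pendantExt_reachable_inr_inl,
    pendantExt_reachable_inl_inr, pendantExt_reachable_inr_inr]
  constructor
  · rintro ⟨hle, hac, hsep, hl, hr⟩
    by_cases hc : c ∈ A
    · refine .inl ⟨?_, hle, hac, fun h => hsep ⟨hc, h⟩, fun x => (hl x).imp_left And.right⟩
      ext d
      have := hr d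
      grind
    · refine .inr ⟨?_, hle, ?_, hac⟩
      · ext d
        have := hr d
        grind
      · have hj : ∀ x, F.Reachable x j := fun x => (hl x).resolve_left fun h => hc h.1
        exact { preconnected := fun x y => (hj x).trans (hj y).symm, nonempty := ⟨v⟩ }
  · rintro (⟨rfl, hle, hac, hsep, h⟩ | ⟨rfl, hle, hconn, hac⟩)
    · simp_all
    · refine ⟨hle, hac, by simp, fun x => .inr (hconn.preconnected x j), fun d => ?_⟩
      have := hconn.preconnected v j
      by_cases hd : d = c <;> simp [hd, this]

lemma isTwoForestSep_pendantExt_inr_inr {A : Set (Fin 2)} {c d : Fin 2} (hcd : c ≠ d) :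
    IsTwoForestSep (pendantExt G v Set.univ) (pendantExt F v A) (.inr c) (.inr d) ↔
      (A = {c} ∨ A = {d}) ∧ IsSpanningTree G F := by
  have hfin : ∀ e, e = c ∨ e = d := by omega
  simp only [IsTwoForestSep, IsSpanningTree, pendantExt_le_iff, pendantExt_isAcyclic_iff,
    Sum.forall, pendantExt_reachable_inl_inr, pendantExt_reachable_inr_inr]
  constructor
  · rintro ⟨hle, hac, hsep, hl, -⟩
    have hv : ∀ x, F.Reachable x v := fun x => (hl x).elim And.right And.right
    refine ⟨?_, hle, { preconnected := fun x y => (hv x).trans (hv y).symm,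
                       nonempty := ⟨v⟩ }, hac⟩
    have := hl v
    have hmem : c ∈ A ∧ d ∉ A ∨ d ∈ A ∧ c ∉ A := by grind
    refine hmem.imp ?_ ?_ <;>
    · rintro ⟨h, h'⟩
      ext e
      have := hfin e
      grind
  · rintro ⟨hA, hle, hconn, hac⟩
    refine ⟨hle, hac, ?_, fun x => ?_, fun e => ?_⟩
    · rcases hA with rfl | rfl <;> simp [hcd, hcd.symm]
    · have := hconn.preconnected x v
      rcases hA with rfl | rfl <;> simp [this]
    · rcases hfin e with rfl | rfl <;> simp

lemma setOf_isTwoForestSep_pendantExt {x y : V ⊕ α} :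
    {H | IsTwoForestSep (pendantExt G v Set.univ) H x y} =
      (fun p : SimpleGraph V × Set α => pendantExt p.1 v p.2) ''
        {p | IsTwoForestSep (pendantExt G v Set.univ) (pendantExt p.1 v p.2) x y} := by
  ext H
  constructor
  · intro h
    have hH := eq_pendantExt_of_le h.1
    refine ⟨(H.comap Sum.inl, {c | H.Adj (.inl v) (.inr c)}), ?_, hH.symm⟩
    change IsTwoForestSep _ (pendantExt (H.comap Sum.inl) v {c | H.Adj (.inl v) (.inr c)}) x y
    rw [← hH]
    exact h
  · rintro ⟨p, hp, rfl⟩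
    exact hp

lemma twoForestCount_pendantExt (x y : V ⊕ α) :
    twoForestCount (pendantExt G v Set.univ) x y =
      {p : SimpleGraph V × Set α |
        IsTwoForestSep (pendantExt G v Set.univ) (pendantExt p.1 v p.2) x y}.ncard := by
  rw [← Set.ncard_image_of_injective _ (pendantExt_injective (v := v)),
    ← setOf_isTwoForestSep_pendantExt]
  rfl

lemma twoForestCount_comm (G : SimpleGraph V) (i j : V) :
    twoForestCount G i j = twoForestCount G j i := by
  unfold twoForestCount IsTwoForestSep
  simp only [SimpleGraph.reachable_comm (u := i) (v := j), or_comm]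

lemma ncard_prod_singleton {β γ : Type*} (s : Set β) (c : γ) :
    (s ×ˢ ({c} : Set γ)).ncard = s.ncard := by
  simp [Set.ncard_prod]

lemma twoForestCount_pendantExt_inl_inl (i j : V) :
    twoForestCount (pendantExt G v (Set.univ : Set α)) (.inl i) (.inl j) =
      twoForestCount G i j := by
  rw [twoForestCount_pendantExt]
  simp only [isTwoForestSep_pendantExt_inl_inl]
  exact Eq.trans (congrArg Set.ncard (by ext; simp [and_comm]))
    (ncard_prod_singleton {F | IsTwoForestSep G F i j} (Set.univ : Set α))

lemma twoForestCount_pendantExt_inr_inl [Finite V] [Finite α] (c : α) (j : V) :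
    twoForestCount (pendantExt G v (Set.univ : Set α)) (.inr c) (.inl j) =
      spanningTreeCount G + twoForestCount G v j := by
  have hdisj : Disjoint ({F | IsSpanningTree G F} ×ˢ {({c}ᶜ : Set α)})
      ({F | IsTwoForestSep G F v j} ×ˢ {(Set.univ : Set α)}) := by
    rw [Set.disjoint_left]
    rintro ⟨F, A⟩ ⟨-, hA⟩ ⟨-, hA'⟩
    simp only [Set.mem_singleton_iff] at hA hA'
    simp [hA] at hA'
  rw [twoForestCount_pendantExt]
  simp only [isTwoForestSep_pendantExt_inr_inl]
  refine Eq.trans (congrArg Set.ncard ?_) ((Set.ncard_union_eq hdisj).trans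
    (congrArg₂ (· + ·) (ncard_prod_singleton _ _) (ncard_prod_singleton _ _)))
  ext p
  simp only [Set.mem_ofPred_eq, Set.mem_union, Set.mem_prod, Set.mem_singleton_iff]
  tauto

lemma twoForestCount_pendantExt_inr_inr [Finite V] {c d : Fin 2} (hcd : c ≠ d) :
    twoForestCount (pendantExt G v Set.univ) (.inr c) (.inr d) = 2 * spanningTreeCount G := by
  rw [twoForestCount_pendantExt]
  simp only [isTwoForestSep_pendantExt_inr_inr hcd]
  have : {p : SimpleGraph V × Set (Fin 2) | (p.2 = {c} ∨ p.2 = {d}) ∧ IsSpanningTree G p.1} =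
      {F | IsSpanningTree G F} ×ˢ {{c}, {d}} := by
    ext p
    simp [and_comm]
  rw [this, Set.ncard_prod, Set.ncard_pair (by simpa using hcd), mul_comm]
  rfl

lemma twoForestCount_self (G : SimpleGraph V) (i : V) : twoForestCount G i i = 0 := by
  simp [twoForestCount, IsTwoForestSep]

lemma degVec_pendantExt_inl [Finite V] [DecidableEq V] [Finite α] (i : V) :
    degVec (pendantExt G v (Set.univ : Set α)) (.inl i) =
      degVec G i + if i = v then (Nat.card α : ℝ) else 0 := by
  have hset : (pendantExt G v (Set.univ : Set α)).neighborSet (.inl i) =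
      Sum.inl '' G.neighborSet i ∪ Sum.inr '' {_c : α | i = v} := by
    ext (a | c) <;> simp
  have hdisj : Disjoint (Sum.inl '' G.neighborSet i : Set (V ⊕ α))
      (Sum.inr '' {_c : α | i = v}) := by
    rw [Set.disjoint_left]
    rintro _ ⟨a, -, rfl⟩ ⟨c, -, h⟩
    cases h
  rw [degVec, hset, Set.ncard_union_eq hdisj, Set.ncard_image_of_injective _ Sum.inl_injective,
    Set.ncard_image_of_injective _ Sum.inr_injective]
  by_cases h : i = v <;> simp [degVec, h, Set.ncard_univ]

lemma degVec_pendantExt_inr (c : α) :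
    degVec (pendantExt G v (Set.univ : Set α)) (.inr c) = 1 := by
  have hset : (pendantExt G v (Set.univ : Set α)).neighborSet (.inr c) = {.inl v} := by
    ext (a | d) <;> simp
  simp [degVec, hset]

lemma sum_degVec [Fintype V] (G : SimpleGraph V) : ∑ i, degVec G i = 2 * edgeCount G := by
  classical
  have h := G.sum_degrees_eq_twice_card_edges
  simp only [degVec, edgeCount, ← SimpleGraph.coe_edgeFinset, ← SimpleGraph.coe_neighborFinset,
    Set.ncard_coe_finset, SimpleGraph.card_neighborFinset_eq_degree]
  exact_mod_cast h

end PendantExt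

theorem tilde_numerator {V : Type*} [Fintype V] [DecidableEq V] [Nontrivial V]
    (G : SimpleGraph V) (hG : G.Connected) (v : V) :
    degVec (tildeG G v) ⬝ᵥ (forestMatrix (tildeG G v)).mulVec (degVec (tildeG G v))
      = degVec G ⬝ᵥ (forestMatrix G).mulVec (degVec G)
        + 8 * (degVec G ⬝ᵥ (forestMatrix G).mulVec (Pi.single v 1))
        + 8 * edgeCount G * (spanningTreeCount G : ℝ)
        + 12 * (spanningTreeCount G : ℝ) := by
  have hcomm : ∀ (c : Fin 2) (j : V),
      twoForestCount (pendantExt G v Set.univ) (.inl j) (.inr c) =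
        spanningTreeCount G + twoForestCount G j v := fun c j => by
    rw [twoForestCount_comm, twoForestCount_pendantExt_inr_inl, twoForestCount_comm G v]
  have hcol : ∑ j, (twoForestCount G v j : ℝ) * degVec G j =
      ∑ j, degVec G j * twoForestCount G j v :=
    Finset.sum_congr rfl fun j _ => by rw [twoForestCount_comm, mul_comm]
  rw [tildeG_eq_pendantExt]
  simp only [dotProduct, mulVec, forestMatrix, Matrix.of_apply, Fintype.sum_sum_type,
    Fin.sum_univ_two, degVec_pendantExt_inl, degVec_pendantExt_inr,
    twoForestCount_pendantExt_inl_inl, twoForestCount_pendantExt_inr_inl, hcomm,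
    twoForestCount_pendantExt_inr_inr zero_ne_one, twoForestCount_pendantExt_inr_inr one_ne_zero,
    twoForestCount_self, Nat.card_eq_fintype_card, Fintype.card_fin, Nat.cast_add, Nat.cast_mul]
  simp only [mul_add, add_mul, Finset.sum_add_distrib, mul_ite, ite_mul, mul_zero, zero_mul,
    Finset.sum_ite_eq', Finset.mem_univ, if_true, Pi.single_apply, mul_one, one_mul,
    Nat.cast_zero, ← Finset.mul_sum, ← Finset.sum_mul, sum_degVec, hcol, twoForestCount_self]
  push_cast
  ring_nf
  simp only [← Finset.sum_mul]
  ring
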